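/- arXiv:2502.08607 — 3 statements merged into one kernel-verified Lean document; each statement's English description precedes it below -/
import Mathlib

section
/- Let T > 0 and x₀ ∈ ℝ, and let x(t) = x₀ · cosh(T − t)/cosh(T) and u(t) = −x₀ · sinh(T − t)/cosh(T). Then the cost of OCP 1 along this pair equals ∫₀^T (x(t)² + u(t)²) dt = x₀² · tanh(T). -/
open Real intervalIntegral

/-- The cost of OCP 1 along the exact solution
`x(t) = x₀ cosh(T−t)/cosh T`, `u(t) = −x₀ sinh(T−t)/cosh T` equals
`x₀² tanh T`. -/
theorem ocp1_exact_cost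
    (T : ℝ) (hT : 0 < T) (x₀ : ℝ)
    (x u : ℝ → ℝ)
    (hx : ∀ t, x t = x₀ * Real.cosh (T - t) / Real.cosh T)
    (hu : ∀ t, u t = -x₀ * Real.sinh (T - t) / Real.cosh T) :
    ∫ t in (0 : ℝ)..T, (x t ^ 2 + u t ^ 2) = x₀ ^ 2 * Real.tanh T := by
  have hc : Real.cosh T ≠ 0 := (Real.cosh_pos T).ne'
  have hd : ∀ t ∈ Set.uIcc (0 : ℝ) T,
      HasDerivAt (fun t => -(x₀ ^ 2 / Real.cosh T ^ 2) * (Real.sinh (T - t) * Real.cosh (T - t)))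
        (x t ^ 2 + u t ^ 2) t := by
    intro t _
    have h1 : HasDerivAt (fun t : ℝ => T - t) (-1) t := by
      simpa using (hasDerivAt_id t).const_sub T
    have h2 := ((h1.sinh.mul h1.cosh).const_mul (-(x₀ ^ 2 / Real.cosh T ^ 2)))
    refine h2.congr_deriv ?_
    rw [hx, hu]
    field_simp
    ring
  have hcont : Continuous (fun t => x t ^ 2 + u t ^ 2) := by
    have ex : x = fun t => x₀ * Real.cosh (T - t) / Real.cosh T := funext hx
    have eu : u = fun t => -x₀ * Real.sinh (T - t) / Real.cosh T := funext hu
    rw [ex, eu]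
    have h1 : Continuous (fun t : ℝ => Real.cosh (T - t)) :=
      Real.continuous_cosh.comp (by fun_prop)
    have h2 : Continuous (fun t : ℝ => Real.sinh (T - t)) :=
      Real.continuous_sinh.comp (by fun_prop)
    exact (((continuous_const.mul h1).div_const _).pow 2).add
      (((continuous_const.mul h2).div_const _).pow 2)
  rw [intervalIntegral.integral_eq_sub_of_hasDerivAt hd (hcont.intervalIntegrable _ _)]
  rw [Real.tanh_eq_sinh_div_cosh]
  simp only [sub_self, sub_zero, Real.sinh_zero]
  field_simp
  ring
end

section
/- Let T > 0 and x₀ ∈ ℝ. For every continuously differentiable function x : ℝ → ℝ with x(0) = x₀, setting u(t) = x'(t), one has ∫₀^T (x(t)² + u(t)²) dt ≥ x₀² · tanh(T). Consequently the pair x*(t) = x₀·cosh(T − t)/cosh(T), u*(t) = −x₀·sinh(T − t)/cosh(T), whose cost equals x₀²·tanh(T), is globally optimal for OCP 1. -/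
open Real intervalIntegral

/-- For every continuously differentiable `x : ℝ → ℝ` with `x 0 = x₀`, taking
`u = x'`, the cost of OCP 1 satisfies `∫₀ᵀ (x² + u²) ≥ x₀² tanh T`.
Consequently the pair `x*(t) = x₀ cosh(T−t)/cosh T`,
`u*(t) = −x₀ sinh(T−t)/cosh T`, whose cost equals `x₀² tanh T`, is globally
optimal for OCP 1. -/
theorem ocp1_global_optimality
    (T : ℝ) (hT : 0 < T) (x₀ : ℝ)
    (xstar ustar : ℝ → ℝ)
    (hxstar : ∀ t, xstar t = x₀ * Real.cosh (T - t) / Real.cosh T)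
    (hustar : ∀ t, ustar t = -x₀ * Real.sinh (T - t) / Real.cosh T) :
    (∀ x : ℝ → ℝ, ContDiff ℝ 1 x → x 0 = x₀ →
      x₀ ^ 2 * Real.tanh T ≤ ∫ t in (0 : ℝ)..T, (x t ^ 2 + deriv x t ^ 2)) ∧
    (∫ t in (0 : ℝ)..T, (xstar t ^ 2 + ustar t ^ 2)) = x₀ ^ 2 * Real.tanh T := by
  have hs : ∀ t, HasDerivAt (fun t => Real.sinh (T - t)) (-Real.cosh (T - t)) t := by
    intro t
    have h := ((hasDerivAt_id t).const_sub T).sinh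
    simpa using h
  have hc : ∀ t, HasDerivAt (fun t => Real.cosh (T - t)) (-Real.sinh (T - t)) t := by
    intro t
    have h := ((hasDerivAt_id t).const_sub T).cosh
    simpa using h
  have hpos : ∀ t, Real.cosh t ≠ 0 := fun t => (Real.cosh_pos t).ne'
  constructor
  · intro x hx hx0
    have hxc : Continuous x := hx.continuous
    have hdc : Continuous (deriv x) := hx.continuous_deriv le_rfl
    have hd : ∀ t, HasDerivAt x (deriv x t) t := fun t =>
      (hx.differentiable one_ne_zero t).hasDerivAt
    have hcs : Continuous (fun t => Real.sinh (T - t) / Real.cosh (T - t)) :=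
      Continuous.div (by fun_prop) (by fun_prop) (fun t => hpos _)
    have hW : ∀ t, HasDerivAt (fun t => -(x t ^ 2 * (Real.sinh (T - t) / Real.cosh (T - t))))
        ((x t ^ 2 + deriv x t ^ 2)
          - (deriv x t + x t * (Real.sinh (T - t) / Real.cosh (T - t))) ^ 2) t := by
      intro t
      have h := (((hd t).pow 2).mul ((hs t).div (hc t) (hpos _))).neg
      refine h.congr_deriv ?_
      have := hpos (T - t)
      simp only [Pi.pow_apply, Pi.div_apply]
      field_simp
      ring
    have hi : Continuous (fun t => (x t ^ 2 + deriv x t ^ 2)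
          - (deriv x t + x t * (Real.sinh (T - t) / Real.cosh (T - t))) ^ 2) := by
      fun_prop
    have hint := intervalIntegral.integral_eq_sub_of_hasDerivAt (a := 0) (b := T)
      (fun t _ => hW t) (hi.intervalIntegrable _ _)
    have hval : x₀ ^ 2 * Real.tanh T = ∫ t in (0 : ℝ)..T, ((x t ^ 2 + deriv x t ^ 2)
          - (deriv x t + x t * (Real.sinh (T - t) / Real.cosh (T - t))) ^ 2) := by
      rw [hint, Real.tanh_eq_sinh_div_cosh]
      simp [hx0]
    rw [hval]
    refine intervalIntegral.integral_mono_on hT.le (hi.intervalIntegrable _ _)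
      (Continuous.intervalIntegrable (by fun_prop) _ _) ?_
    intro t _
    linarith [sq_nonneg (deriv x t + x t * (Real.sinh (T - t) / Real.cosh (T - t)))]
  · obtain rfl : xstar = _ := funext hxstar
    obtain rfl : ustar = _ := funext hustar
    have hW : ∀ t, HasDerivAt (fun t => (x₀ * Real.cosh (T - t) / Real.cosh T) *
        (-x₀ * Real.sinh (T - t) / Real.cosh T))
        ((x₀ * Real.cosh (T - t) / Real.cosh T) ^ 2 +
          (-x₀ * Real.sinh (T - t) / Real.cosh T) ^ 2) t := by
      intro t
      have h := (((hc t).const_mul x₀).div_const (Real.cosh T)).mul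
        (((hs t).const_mul (-x₀)).div_const (Real.cosh T))
      refine h.congr_deriv ?_
      ring
    rw [intervalIntegral.integral_eq_sub_of_hasDerivAt (fun t _ => hW t)
      (Continuous.intervalIntegrable (by fun_prop) _ _), Real.tanh_eq_sinh_div_cosh]
    have := hpos T
    simp
    field_simp
end

section
/- Let x₀ ∈ (0, 4). Define x(t) = 4·x₀ / (x₀ + (4 − x₀)·exp(5t/2)) for t ≥ 0. Then the denominator x₀ + (4 − x₀)·exp(5t/2) is strictly positive for all t ≥ 0, x(0) = x₀, and x satisfies the closed-loop state equation x'(t) = (5/8)·x(t)² − (5/2)·x(t) for all t ≥ 0. -/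
open Real

/-- For `x₀ ∈ (0, 4)`, the function `x(t) = 4x₀ / (x₀ + (4 − x₀)e^{5t/2})`
has strictly positive denominator for all `t ≥ 0`, satisfies `x(0) = x₀`, and
solves the closed-loop state equation `x' = (5/8)x² − (5/2)x` for `t ≥ 0`. -/
theorem ocp2_exact_state_trajectory
    (x₀ : ℝ) (hx₀ : x₀ ∈ Set.Ioo (0 : ℝ) 4)
    (x : ℝ → ℝ)
    (hx : ∀ t, x t = 4 * x₀ / (x₀ + (4 - x₀) * Real.exp (5 * t / 2))) :
    (∀ t : ℝ, 0 ≤ t → 0 < x₀ + (4 - x₀) * Real.exp (5 * t / 2)) ∧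
    x 0 = x₀ ∧
    (∀ t : ℝ, 0 ≤ t → HasDerivAt x ((5 / 8) * x t ^ 2 - (5 / 2) * x t) t) := by
  obtain ⟨h0, h4⟩ := hx₀
  have hpos : ∀ t : ℝ, 0 < x₀ + (4 - x₀) * Real.exp (5 * t / 2) := fun t =>
    add_pos h0 (mul_pos (sub_pos.2 h4) (Real.exp_pos _))
  refine ⟨fun t _ => hpos t, ?_, ?_⟩
  · rw [hx]
    simp
  · intro t _
    have hD := (hpos t).ne'
    have h1 : HasDerivAt (fun s : ℝ => 5 * s / 2) (5 * 1 / 2) t :=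
      ((hasDerivAt_id' t).const_mul 5).div_const 2
    have h2 := (h1.exp.const_mul (4 - x₀)).const_add x₀
    have h3 := (hasDerivAt_const t (4 * x₀)).fun_div h2 hD
    have hfun : x = fun s => 4 * x₀ / (x₀ + (4 - x₀) * Real.exp (5 * s / 2)) := funext hx
    rw [hx t, hfun]
    refine h3.congr_deriv ?_
    generalize Real.exp (5 * t / 2) = E at hD ⊢
    field_simp
    ring
end
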